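/- Let q be complex with |q| < 1, let b be a complex number with b q^m != 1 for every integer m >= 1, and let a be a nonzero complex number. Then sum_{j,k >= 0} a^{2j} b^k q^{j(j+1) + (j+k)^2} (b^2 q^k / a^2; q)_j / ((bq;q)_{2j+2k} (q;q)_k (q;q)_j) = (bq;q)_inf^{-1} sum_{i >= 0} a^{2i} q^{C(2i+1,2)} / (q;q)_i. -/

import Mathlib

open scoped BigOperators

noncomputable section

/-- Finite q-Pochhammer symbol `(a;q)_n`. -/
def qP (q a : ℂ) (n : ℕ) : ℂ := ∏ m ∈ Finset.range n, (1 - a * q ^ m)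

/-- Infinite q-Pochhammer symbol `(a;q)_∞`. -/
def qPInf (q a : ℂ) : ℂ := ∏' m : ℕ, (1 - a * q ^ m)

theorem qP_succ (q a : ℂ) (n : ℕ) : qP q a (n + 1) = qP q a n * (1 - a * q ^ n) := by
  simp [qP, Finset.prod_range_succ]

theorem qP_zero (q a : ℂ) : qP q a 0 = 1 := by simp [qP]

theorem qP_add (q a : ℂ) (n m : ℕ) : qP q a (n + m) = qP q a n * qP q (a * q ^ n) m := by
  simp only [qP, Finset.prod_range_add]
  congr 1
  apply Finset.prod_congr rfl
  intros
  ring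

theorem qP_ne_zero {q a : ℂ} (h : ∀ m : ℕ, a * q ^ m ≠ 1) (n : ℕ) : qP q a n ≠ 0 := by
  rw [qP, Finset.prod_ne_zero_iff]
  intro m _ h0
  exact h m (sub_eq_zero.mp h0).symm

theorem qq_ne {q : ℂ} (hq : ‖q‖ < 1) (m : ℕ) : q * q ^ m ≠ 1 := by
  intro h
  have h1 : ‖q ^ (m + 1)‖ = 1 := by rw [pow_succ', h, norm_one]
  rw [norm_pow] at h1
  have := pow_lt_one₀ (norm_nonneg q) hq (Nat.succ_ne_zero m)
  simp only [Nat.succ_eq_add_one] at this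
  linarith

theorem qP_norm_le {q : ℂ} (hq : ‖q‖ < 1) (z : ℂ) (n : ℕ) :
    ‖qP q z n‖ ≤ Real.exp (‖z‖ * (1 - ‖q‖)⁻¹) := by
  have hs := summable_geometric_of_lt_one (norm_nonneg q) hq
  calc ‖qP q z n‖ = ∏ m ∈ Finset.range n, ‖1 - z * q ^ m‖ := by rw [qP, norm_prod]
    _ ≤ ∏ m ∈ Finset.range n, Real.exp (‖z‖ * ‖q‖ ^ m) := by
      apply Finset.prod_le_prod
      · intros; positivity
      · intro m _
        have h1 : ‖1 - z * q ^ m‖ ≤ 1 + ‖z‖ * ‖q‖ ^ m := by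
          have := norm_sub_le (1 : ℂ) (z * q ^ m)
          simpa using this
        have := Real.add_one_le_exp (‖z‖ * ‖q‖ ^ m)
        linarith
    _ = Real.exp (‖z‖ * ∑ m ∈ Finset.range n, ‖q‖ ^ m) := by
      rw [← Real.exp_sum, Finset.mul_sum]
    _ ≤ _ := by
      apply Real.exp_le_exp.mpr
      apply mul_le_mul_of_nonneg_left _ (norm_nonneg z)
      rw [← tsum_geometric_of_lt_one (norm_nonneg q) hq]
      exact hs.sum_le_tsum _ (fun i _ => by positivity)

theorem summ_aux {q : ℂ} (hq : ‖q‖ < 1) (z : ℂ) : Summable (fun m : ℕ => ‖-(z * q ^ m)‖) := by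
  have hs := summable_geometric_of_lt_one (norm_nonneg q) hq
  simpa using hs.mul_left ‖z‖

theorem qP_tendsto {q : ℂ} (hq : ‖q‖ < 1) (z : ℂ) :
    Filter.Tendsto (fun n => qP q z n) Filter.atTop (nhds (qPInf q z)) := by
  have := (multipliable_one_add_of_summable (summ_aux hq z)).hasProd.tendsto_prod_nat
  simpa [qP, qPInf, sub_eq_add_neg] using this

theorem qPInf_ne {q z : ℂ} (hq : ‖q‖ < 1) (h : ∀ m : ℕ, z * q ^ m ≠ 1) : qPInf q z ≠ 0 := by
  have := tprod_one_add_ne_zero_of_summable (f := fun m : ℕ => -(z * q ^ m)) (fun m h0 => by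
    apply h m
    linear_combination -h0) (summ_aux hq z)
  simpa [qPInf, sub_eq_add_neg] using this

theorem qP_inv_bound {q z : ℂ} (hq : ‖q‖ < 1) (h : ∀ m : ℕ, z * q ^ m ≠ 1) :
    ∃ C : ℝ, 0 ≤ C ∧ ∀ n, ‖(qP q z n)⁻¹‖ ≤ C := by
  have ht := ((qP_tendsto hq z).inv₀ (qPInf_ne hq h)).norm
  obtain ⟨C, hC⟩ := ht.bddAbove_range
  have : ∀ n, ‖(qP q z n)⁻¹‖ ≤ C := fun n => hC ⟨n, rfl⟩
  exact ⟨C, (norm_nonneg _).trans (this 0), this⟩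

theorem summable_theta {ρ : ℝ} (h0 : 0 ≤ ρ) (h1 : ρ < 1) {t : ℝ} (ht : 0 ≤ t) :
    Summable (fun j : ℕ => t ^ j * ρ ^ (j ^ 2)) := by
  apply Summable.of_norm_bounded_eventually_nat (summable_geometric_two)
  have h2 : Filter.Tendsto (fun j : ℕ => t * ρ ^ j) Filter.atTop (nhds (t * 0)) :=
    (tendsto_pow_atTop_nhds_zero_of_lt_one h0 h1).const_mul t
  rw [mul_zero] at h2
  filter_upwards [h2.eventually_le_const (show (0 : ℝ) < 1 / 2 by norm_num)] with j hj
  rw [Real.norm_of_nonneg (by positivity), pow_two, pow_mul, ← mul_pow]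
  exact pow_le_pow_left₀ (by positivity) hj j

/-- Weighted sum with q-binomial coefficients. -/
theorem pascal_sum {q : ℂ} (hq : ‖q‖ < 1) (f : ℕ → ℕ → ℂ) (N : ℕ) :
    ∑ p ∈ Finset.HasAntidiagonal.antidiagonal (N + 1),
        qP q q (N + 1) / (qP q q p.1 * qP q q p.2) * f p.1 p.2 =
      ∑ p ∈ Finset.HasAntidiagonal.antidiagonal N,
        qP q q N / (qP q q p.1 * qP q q p.2) * (f p.1 (p.2 + 1) + q ^ p.2 * f (p.1 + 1) p.2) := by
  have hne := qP_ne_zero (qq_ne hq)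
  have hne1 : ∀ m, 1 - q * q ^ m ≠ 0 := fun m h => qq_ne hq m (sub_eq_zero.mp h).symm
  have h1 : ∑ p ∈ Finset.HasAntidiagonal.antidiagonal (N + 1),
        qP q q (N + 1) / (qP q q p.1 * qP q q p.2) * f p.1 p.2 =
      (∑ p ∈ Finset.HasAntidiagonal.antidiagonal (N + 1),
        qP q q N * (1 - q ^ p.2) / (qP q q p.1 * qP q q p.2) * f p.1 p.2) +
      ∑ p ∈ Finset.HasAntidiagonal.antidiagonal (N + 1),
        qP q q N * (q ^ p.2 * (1 - q ^ p.1)) / (qP q q p.1 * qP q q p.2) * f p.1 p.2 := by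
    rw [← Finset.sum_add_distrib]
    apply Finset.sum_congr rfl
    rintro ⟨m, l⟩ h
    rw [Finset.HasAntidiagonal.mem_antidiagonal] at h
    simp only at h ⊢
    rw [qP_succ, ← pow_succ', ← h, pow_add]
    ring
  rw [h1, Finset.Nat.sum_antidiagonal_succ', Finset.Nat.sum_antidiagonal_succ]
  simp only [pow_zero, sub_self, mul_zero, zero_div, zero_mul, zero_add]
  rw [← Finset.sum_add_distrib]
  apply Finset.sum_congr rfl
  rintro ⟨m, l⟩ h
  have a1 := hne m
  have a2 := hne l
  have a3 := hne1 m
  have a4 := hne1 l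
  simp only [qP_succ, pow_succ']
  field_simp

theorem q_binomial {q : ℂ} (hq : ‖q‖ < 1) (z : ℂ) (N : ℕ) :
    qP q z N = ∑ p ∈ Finset.HasAntidiagonal.antidiagonal N,
      qP q q N / (qP q q p.1 * qP q q p.2) * ((-z) ^ p.1 * q ^ (p.1.choose 2)) := by
  induction N with
  | zero => simp [qP_zero]
  | succ N ih =>
    rw [pascal_sum hq (fun s _ => (-z) ^ s * q ^ (s.choose 2)), qP_succ, ih, Finset.sum_mul]
    apply Finset.sum_congr rfl
    rintro ⟨s, t⟩ h
    rw [Finset.HasAntidiagonal.mem_antidiagonal] at h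
    simp only at h ⊢
    rw [Nat.choose_succ_succ' s 1, Nat.choose_one_right, ← h]
    ring

theorem cauchy_fin {q : ℂ} (hq : ‖q‖ < 1) (N : ℕ) : ∀ (B : ℂ) (_ : ∀ m : ℕ, B * q * q ^ m ≠ 1),
    ∑ p ∈ Finset.HasAntidiagonal.antidiagonal N,
      qP q q N / (qP q q p.1 * qP q q p.2) * (q ^ (p.1 ^ 2) * B ^ p.1 / qP q (B * q) p.1) =
      (qP q (B * q) N)⁻¹ := by
  induction N with
  | zero => intro B _; simp [qP_zero]
  | succ N ih =>
    intro B hB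
    rw [pascal_sum hq (fun s _ => q ^ (s ^ 2) * B ^ s / qP q (B * q) s)]
    have hB' : ∀ m : ℕ, B * q * q * q ^ m ≠ 1 := fun m h => hB (m + 1) (by rw [← h]; ring)
    have e1 := ih B hB
    have e2 := ih (B * q) hB'
    have hs : ∀ n, qP q (B * q) (n + 1) = (1 - B * q) * qP q (B * q * q) n := by
      intro n
      rw [add_comm, qP_add]
      simp [qP]
    have n0 : 1 - B * q ≠ 0 := fun h => hB 0 (by linear_combination -h)
    have n1 : 1 - B * q * q ^ N ≠ 0 := fun h => hB N (by linear_combination -h)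
    have n2 := qP_ne_zero hB
    have n3 := qP_ne_zero hB'
    have key : ∑ p ∈ Finset.HasAntidiagonal.antidiagonal N,
        qP q q N / (qP q q p.1 * qP q q p.2) * (q ^ (p.1 ^ 2) * B ^ p.1 / qP q (B * q) p.1 +
          q ^ p.2 * (q ^ ((p.1 + 1) ^ 2) * B ^ (p.1 + 1) / qP q (B * q) (p.1 + 1))) =
        (qP q (B * q) N)⁻¹ + B * q ^ (N + 1) / (1 - B * q) * (qP q (B * q * q) N)⁻¹ := by
      rw [← e1, ← e2, Finset.mul_sum, ← Finset.sum_add_distrib]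
      apply Finset.sum_congr rfl
      rintro ⟨s, t⟩ h
      rw [Finset.HasAntidiagonal.mem_antidiagonal] at h
      simp only at h ⊢
      rw [hs, ← h]
      have a1 := n3 s
      have a2 := n2 s
      rw [mul_add]
      congr 1
      rw [mul_left_comm (B * q ^ (s + t + 1) / (1 - B * q))]
      congr 1
      generalize qP q (B * q * q) s = w at a1 ⊢
      field_simp
      ring
    rw [key]
    have h4 : (1 - B * q) * qP q (B * q * q) N = qP q (B * q) N * (1 - B * q * q ^ N) := by
      rw [← hs, qP_succ]
    have : B * q ^ (N + 1) / (1 - B * q) * (qP q (B * q * q) N)⁻¹ =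
        B * q ^ (N + 1) / (qP q (B * q) N * (1 - B * q * q ^ N)) := by
      rw [← h4]
      field_simp
    rw [this, qP_succ]
    have a2 := n2 N
    field_simp
    ring

theorem cauchy_inf {q : ℂ} (hq : ‖q‖ < 1) (B : ℂ) (hB : ∀ m : ℕ, B * q * q ^ m ≠ 1) :
    ∑' m : ℕ, q ^ (m ^ 2) * B ^ m / (qP q (B * q) m * qP q q m) = (qPInf q (B * q))⁻¹ := by
  obtain ⟨C1, hC1, h1⟩ := qP_inv_bound hq hB
  obtain ⟨C2, hC2, h2⟩ := qP_inv_bound hq (qq_ne hq)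
  have h3 := qP_norm_le hq q
  set P := Real.exp (‖q‖ * (1 - ‖q‖)⁻¹) with hP
  have hP0 : 0 ≤ P := (Real.exp_pos _).le
  have lim1 := (qP_tendsto hq (B * q)).inv₀ (qPInf_ne hq hB)
  set F : ℕ → ℕ → ℂ := fun N m => if m ≤ N then
    qP q q N * (qP q q (N - m))⁻¹ * (q ^ (m ^ 2) * B ^ m * (qP q (B * q) m)⁻¹ * (qP q q m)⁻¹) else 0
    with hF
  have hsum : ∀ N, ∑' m, F N m = (qP q (B * q) N)⁻¹ := by
    intro N
    rw [← cauchy_fin hq N B hB, Finset.Nat.sum_antidiagonal_eq_sum_range_succ_mk,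
      tsum_eq_sum (s := Finset.range N.succ)]
    · apply Finset.sum_congr rfl
      intro m hm
      have : m ≤ N := Nat.lt_succ_iff.mp (Finset.mem_range.mp hm)
      simp only [hF, this, if_true]
      rw [div_eq_mul_inv, div_eq_mul_inv, mul_inv]
      ring
    · intro m hm
      have : ¬ m ≤ N := fun h => hm (Finset.mem_range.mpr (Nat.lt_succ_iff.mpr h))
      simp [hF, this]
  have hlim : Filter.Tendsto (fun N => ∑' m, F N m) Filter.atTop
      (nhds (∑' m : ℕ, q ^ (m ^ 2) * B ^ m / (qP q (B * q) m * qP q q m))) := by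
    apply tendsto_tsum_of_dominated_convergence
      (bound := fun m => (P * C2 * C1 * C2) * (‖B‖ ^ m * ‖q‖ ^ (m ^ 2)))
    · exact (summable_theta (norm_nonneg q) hq (norm_nonneg B)).mul_left _
    · intro m
      have l1 := qP_tendsto hq q
      have l3 : Filter.Tendsto (fun N => (qP q q (N - m))⁻¹) Filter.atTop (nhds (qPInf q q)⁻¹) :=
        (l1.inv₀ (qPInf_ne hq (qq_ne hq))).comp (Filter.tendsto_sub_atTop_nat m)
      have l4 := (l1.mul l3).mul_const
        (q ^ (m ^ 2) * B ^ m * (qP q (B * q) m)⁻¹ * (qP q q m)⁻¹)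
      rw [mul_inv_cancel₀ (qPInf_ne hq (qq_ne hq)), one_mul] at l4
      have e : q ^ (m ^ 2) * B ^ m / (qP q (B * q) m * qP q q m) =
        q ^ (m ^ 2) * B ^ m * (qP q (B * q) m)⁻¹ * (qP q q m)⁻¹ := by
        rw [div_eq_mul_inv, mul_inv]; ring
      rw [e]
      apply l4.congr'
      filter_upwards [Filter.eventually_ge_atTop m] with N hN
      simp [hF, hN]
    · refine Filter.Eventually.of_forall (fun N m => ?_)
      simp only [hF]
      split_ifs
      · have : ‖qP q q N * (qP q q (N - m))⁻¹ *
            (q ^ (m ^ 2) * B ^ m * (qP q (B * q) m)⁻¹ * (qP q q m)⁻¹)‖ =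
            (‖qP q q N‖ * ‖(qP q q (N - m))⁻¹‖ * ‖(qP q (B * q) m)⁻¹‖ * ‖(qP q q m)⁻¹‖) *
            (‖B‖ ^ m * ‖q‖ ^ (m ^ 2)) := by
          simp only [norm_mul, norm_pow]; ring
        rw [this]
        gcongr
        · exact h3 N
        · exact h2 _
        · exact h1 _
        · exact h2 _
      · rw [norm_zero]; positivity
  simp only [hsum] at hlim
  exact tendsto_nhds_unique hlim lim1

theorem tsum_antidiag {f : ℕ × ℕ → ℂ} (hf : Summable f) :
    ∑' p, f p = ∑' n, ∑ p ∈ Finset.HasAntidiagonal.antidiagonal n, f p := by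
  rw [← Finset.HasAntidiagonal.sigmaAntidiagonalEquivProd.tsum_eq f]
  have hs : Summable (fun c : (n : ℕ) × Finset.HasAntidiagonal.antidiagonal n =>
      f (Finset.HasAntidiagonal.sigmaAntidiagonalEquivProd c)) :=
    Finset.HasAntidiagonal.sigmaAntidiagonalEquivProd.summable_iff.mpr hf
  rw [Summable.tsum_sigma' (fun n => (hasSum_fintype _).summable) hs]
  apply tsum_congr
  intro n
  rw [tsum_fintype, ← Finset.sum_coe_sort (Finset.HasAntidiagonal.antidiagonal n) f]
  rfl

theorem drie_summable {q : ℂ} (hq : ‖q‖ < 1) (A b : ℂ) (f : ℕ × ℕ → ℂ) (C : ℝ) (hC : 0 ≤ C)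
    (h : ∀ j k, ∃ e, j ^ 2 + k ^ 2 ≤ e ∧ ‖f (j, k)‖ ≤ C * (‖A‖ ^ j * ‖b‖ ^ k * ‖q‖ ^ e)) :
    Summable f := by
  have s := (summable_theta (norm_nonneg q) hq (norm_nonneg A)).mul_of_nonneg
    (summable_theta (norm_nonneg q) hq (norm_nonneg b)) (fun _ => by positivity)
    (fun _ => by positivity)
  apply Summable.of_norm_bounded (s.mul_left C)
  rintro ⟨j, k⟩
  obtain ⟨e, he, hh⟩ := h j k
  refine hh.trans ?_
  have h5 : ‖q‖ ^ e ≤ ‖q‖ ^ (j ^ 2) * ‖q‖ ^ (k ^ 2) := by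
    rw [← pow_add]
    exact pow_le_pow_of_le_one (norm_nonneg q) hq.le he
  calc C * (‖A‖ ^ j * ‖b‖ ^ k * ‖q‖ ^ e)
      ≤ C * (‖A‖ ^ j * ‖b‖ ^ k * (‖q‖ ^ (j ^ 2) * ‖q‖ ^ (k ^ 2))) := by gcongr
    _ = _ := by ring

/-- The finite identity. -/
theorem drie_fin {q b A : ℂ} (hq : ‖q‖ < 1) (hb : ∀ m : ℕ, b * q * q ^ m ≠ 1) (hA : A ≠ 0)
    (n : ℕ) :
    ∑ x ∈ Finset.HasAntidiagonal.antidiagonal n, A ^ x.1 * b ^ x.2 * q ^ (x.1 * (x.1 + 1) + (x.1 + x.2) ^ 2) *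
        qP q (b ^ 2 * q ^ x.2 / A) x.1 /
        (qP q (b * q) (2 * x.1 + 2 * x.2) * qP q q x.2 * qP q q x.1) =
    ∑ x ∈ Finset.HasAntidiagonal.antidiagonal n, A ^ x.1 * b ^ x.2 * q ^ (x.1 * (x.1 + 1) + (x.1 + x.2) ^ 2) /
        (qP q (b * q) (2 * x.1 + x.2) * qP q q x.1 * qP q q x.2) := by
  have hne := qP_ne_zero (qq_ne hq)
  have hnb := qP_ne_zero hb
  set T : ℕ → ℕ → ℕ → ℂ := fun r s k => A ^ r * b ^ (k + 2 * s) * (-1) ^ s *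
    q ^ (s.choose 2 + k * s + (r + s) * (r + s + 1) + n ^ 2) /
    (qP q (b * q) (2 * n) * qP q q k * qP q q r * qP q q s) with hT
  have hL : ∀ x ∈ Finset.HasAntidiagonal.antidiagonal n,
      A ^ x.1 * b ^ x.2 * q ^ (x.1 * (x.1 + 1) + (x.1 + x.2) ^ 2) *
        qP q (b ^ 2 * q ^ x.2 / A) x.1 /
        (qP q (b * q) (2 * x.1 + 2 * x.2) * qP q q x.2 * qP q q x.1) =
      ∑ y ∈ Finset.HasAntidiagonal.antidiagonal x.1, T y.1 y.2 x.2 := by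
    rintro ⟨j, k⟩ h
    rw [Finset.HasAntidiagonal.mem_antidiagonal] at h
    simp only at h ⊢
    rw [q_binomial hq, Finset.mul_sum, Finset.sum_div,
      ← Finset.Nat.sum_antidiagonal_swap (n := j) (f := fun y => T y.1 y.2 k)]
    apply Finset.sum_congr rfl
    rintro ⟨s, r⟩ h'
    rw [Finset.HasAntidiagonal.mem_antidiagonal] at h'
    simp only [hT, Prod.fst_swap, Prod.snd_swap] at h' ⊢
    have a1 := hne j
    have a2 := hne k
    have a3 := hne r
    have a4 := hne s
    have a5 := hnb (2 * n)
    rw [← mul_add, h, ← h']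
    rw [← h'] at a1
    rw [neg_pow, div_pow, mul_pow]
    field_simp
    ring
  have hR : ∀ x ∈ Finset.HasAntidiagonal.antidiagonal n,
      A ^ x.1 * b ^ x.2 * q ^ (x.1 * (x.1 + 1) + (x.1 + x.2) ^ 2) /
        (qP q (b * q) (2 * x.1 + x.2) * qP q q x.1 * qP q q x.2) =
      ∑ y ∈ Finset.HasAntidiagonal.antidiagonal x.2, T x.1 y.1 y.2 := by
    rintro ⟨r, m⟩ h
    rw [Finset.HasAntidiagonal.mem_antidiagonal] at h
    simp only at h ⊢
    have e1 : qP q (b * q) (2 * n) =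
        qP q (b * q) (2 * r + m) * qP q (b * q * q ^ (2 * r + m)) m := by
      rw [← qP_add]; congr 1; omega
    have a5 := hnb (2 * n)
    have a6 : qP q (b * q * q ^ (2 * r + m)) m ≠ 0 := fun h0 => a5 (by rw [e1, h0, mul_zero])
    have a7 := hnb (2 * r + m)
    have e2 : A ^ r * b ^ m * q ^ (r * (r + 1) + (r + m) ^ 2) /
        (qP q (b * q) (2 * r + m) * qP q q r * qP q q m) =
        A ^ r * b ^ m * q ^ (r * (r + 1) + (r + m) ^ 2) *
          qP q (b * q * q ^ (2 * r + m)) m / (qP q (b * q) (2 * n) * qP q q r * qP q q m) := by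
      have a1 := hne r
      have a2 := hne m
      rw [e1]
      field_simp
    rw [e2, q_binomial hq, Finset.mul_sum, Finset.sum_div]
    apply Finset.sum_congr rfl
    rintro ⟨s, k⟩ h'
    rw [Finset.HasAntidiagonal.mem_antidiagonal] at h'
    simp only [hT] at h' ⊢
    have a1 := hne m
    have a2 := hne k
    have a3 := hne r
    have a4 := hne s
    rw [h, ← h']
    rw [← h'] at a1
    rw [neg_pow]
    field_simp
    ring
  rw [Finset.sum_congr rfl hL, Finset.sum_congr rfl hR]
  rw [Finset.sum_sigma', Finset.sum_sigma']
  refine Finset.sum_nbij' (fun x => ⟨(x.2.1, x.2.2 + x.1.2), (x.2.2, x.1.2)⟩)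
    (fun x => ⟨(x.1.1 + x.2.1, x.2.2), (x.1.1, x.2.1)⟩) ?_ ?_ ?_ ?_ ?_
  · rintro ⟨⟨j, k⟩, ⟨r, s⟩⟩ h
    simp at h ⊢
    omega
  · rintro ⟨⟨r, m⟩, ⟨s, k⟩⟩ h
    simp at h ⊢
    omega
  · rintro ⟨⟨j, k⟩, ⟨r, s⟩⟩ h
    simp at h ⊢
    omega
  · rintro ⟨⟨r, m⟩, ⟨s, k⟩⟩ h
    simp at h ⊢
    omega
  · rintro ⟨⟨j, k⟩, ⟨r, s⟩⟩ h
    rfl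

/-- Identity (3.28) of the paper. -/
theorem drie_identity (q b a : ℂ) (hq : ‖q‖ < 1)
    (hb : ∀ m : ℕ, 1 ≤ m → b * q ^ m ≠ 1) (ha : a ≠ 0) :
    (∑' x : ℕ × ℕ,
      a ^ (2 * x.1) * b ^ x.2 * q ^ (x.1 * (x.1 + 1) + (x.1 + x.2) ^ 2) *
        qP q (b ^ 2 * q ^ x.2 / a ^ 2) x.1 /
        (qP q (b * q) (2 * x.1 + 2 * x.2) * qP q q x.2 * qP q q x.1))
    = (qPInf q (b * q))⁻¹ *
        ∑' i : ℕ, a ^ (2 * i) * q ^ (i * (2 * i + 1)) / qP q q i := by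
  have hb' : ∀ m : ℕ, b * q * q ^ m ≠ 1 := fun m h => hb (m + 1) (by omega) (by rw [← h]; ring)
  have hA : a ^ 2 ≠ 0 := pow_ne_zero 2 ha
  simp only [pow_mul a 2]
  set A := a ^ 2 with hAdef
  obtain ⟨C1, hC1, h1⟩ := qP_inv_bound hq hb'
  obtain ⟨C2, hC2, h2⟩ := qP_inv_bound hq (qq_ne hq)
  have hnb := qP_ne_zero hb'
  have hs : Summable (fun x : ℕ × ℕ =>
      A ^ x.1 * b ^ x.2 * q ^ (x.1 * (x.1 + 1) + (x.1 + x.2) ^ 2) /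
        (qP q (b * q) (2 * x.1 + x.2) * qP q q x.1 * qP q q x.2)) := by
    apply drie_summable hq A b _ (C1 * C2 * C2) (by positivity)
    intro j k
    refine ⟨j * (j + 1) + (j + k) ^ 2, by nlinarith [Nat.zero_le (j * k), Nat.zero_le (j ^ 2), Nat.zero_le j], ?_⟩
    rw [div_eq_mul_inv, mul_inv, mul_inv]
    simp only [norm_mul, norm_pow]
    rw [mul_comm]
    gcongr
    · exact h1 _
    · exact h2 _
    · exact h2 _
  have hs2 : Summable (fun x : ℕ × ℕ =>
      A ^ x.1 * b ^ x.2 * q ^ (x.1 * (x.1 + 1) + (x.1 + x.2) ^ 2) *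
        qP q (b ^ 2 * q ^ x.2 / A) x.1 /
        (qP q (b * q) (2 * x.1 + 2 * x.2) * qP q q x.2 * qP q q x.1)) := by
    set K := Real.exp (‖b ^ 2 / A‖ * (1 - ‖q‖)⁻¹) with hK
    have hK0 : 0 ≤ K := (Real.exp_pos _).le
    have hK1 : ∀ k n, ‖qP q (b ^ 2 * q ^ k / A) n‖ ≤ K := by
      intro k n
      refine (qP_norm_le hq _ n).trans (Real.exp_le_exp.mpr ?_)
      have h0 : 0 ≤ (1 - ‖q‖)⁻¹ := inv_nonneg.mpr (by linarith)
      apply mul_le_mul_of_nonneg_right _ h0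
      have e : b ^ 2 * q ^ k / A = b ^ 2 / A * q ^ k := by ring
      rw [e, norm_mul, norm_pow]
      exact mul_le_of_le_one_right (norm_nonneg _) (pow_le_one₀ (norm_nonneg q) hq.le)
    apply drie_summable hq A b _ (K * (C1 * C2 * C2)) (by positivity)
    intro j k
    refine ⟨j * (j + 1) + (j + k) ^ 2, by nlinarith [Nat.zero_le (j * k), Nat.zero_le (j ^ 2), Nat.zero_le j], ?_⟩
    rw [div_eq_mul_inv, mul_inv, mul_inv, mul_assoc, mul_comm]
    simp only [norm_mul, norm_pow]
    gcongr
    · exact hK1 _ _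
    · exact h1 _
    · exact h2 _
    · exact h2 _
  rw [tsum_antidiag hs2, tsum_congr (drie_fin hq hb' hA), ← tsum_antidiag hs]
  rw [hs.tsum_prod, ← tsum_mul_left]
  apply tsum_congr
  intro r
  have hB : ∀ m : ℕ, b * q ^ (2 * r) * q * q ^ m ≠ 1 := fun m h =>
    hb' (2 * r + m) (by rw [← h]; ring)
  have hc := cauchy_inf hq (b * q ^ (2 * r)) hB
  have hinf : qPInf q (b * q) = qP q (b * q) (2 * r) * qPInf q (b * q ^ (2 * r) * q) := by
    have l1 := (qP_tendsto hq (b * q ^ (2 * r) * q)).const_mul (qP q (b * q) (2 * r))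
    have l2 := (qP_tendsto hq (b * q)).comp (Filter.tendsto_add_atTop_nat (2 * r))
    refine tendsto_nhds_unique l2 (l1.congr (fun n => ?_))
    simp only [Function.comp]
    rw [add_comm n, qP_add]
    congr 2
    ring
  rw [hinf, mul_inv, ← hc, ← tsum_mul_left, ← tsum_mul_right]
  apply tsum_congr
  intro m
  have e3 : b * q * q ^ (2 * r) = b * q ^ (2 * r) * q := by ring
  simp only [qP_add, e3]
  simp only [div_eq_mul_inv, mul_inv]
  ring
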